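/- arXiv:2206.12970 — 2 statements merged into one kernel-verified Lean document; each statement's English description precedes it below -/
import Mathlib

section
/- Let π_LOC be any output of the greedy concatenation algorithm. Then there exists an optimal checking sequence π* with π_LOC ⊆ π*. -/
noncomputable section

/-- Parameters of the cost-asymmetric memory-hard password hashing model:
`n` passwords with probabilities `p 1 >= ... >= p n`, `m` breakpoints with
probabilities `q 1, ..., q m`, running-time breakpoints `t 0 < t 1 < ... < t m`,
memory-cost constant `cM` and password value `v`. -/
structure Params where
  n : ℕ
  m : ℕ
  p : ℕ → ℝ
  q : ℕ → ℝ
  t : ℕ → ℝ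
  cM : ℝ
  v : ℝ

namespace Params

/-- The standing hypotheses on the parameters. -/
structure Hyp (P : Params) : Prop where
  hn : 1 ≤ P.n
  hm : 1 ≤ P.m
  p_pos : ∀ i ∈ Finset.Icc 1 P.n, 0 < P.p i
  p_anti : ∀ i ∈ Finset.Icc 1 P.n, ∀ i' ∈ Finset.Icc 1 P.n, i ≤ i' → P.p i' ≤ P.p i
  p_sum : ∑ i ∈ Finset.Icc 1 P.n, P.p i ≤ 1
  q_nonneg : ∀ j ∈ Finset.Icc 1 P.m, 0 ≤ P.q j
  q_sum : ∑ j ∈ Finset.Icc 1 P.m, P.q j = 1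
  t_zero : P.t 0 = 0
  t_mono : ∀ j j', j < j' → j' ≤ P.m → P.t j < P.t j'
  cM_pos : 0 < P.cM
  v_pos : 0 < P.v

/-- Cumulative breakpoint probability `Q j = q 1 + ... + q j`. -/
def Q (P : Params) (j : ℕ) : ℝ := ∑ j' ∈ Finset.Icc 1 j, P.q j'

/-- Round cost `c(i, j) = cM * (t j ^ 2 - t (j-1) ^ 2)` of executing an
instruction with label index `j` (it does not depend on the password index). -/
def rc (P : Params) (j : ℕ) : ℝ := P.cM * (P.t j ^ 2 - P.t (j - 1) ^ 2)

/-- A checking sequence is determined by its exponent vector `τ`: for each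
password `i ∈ [1, n]` the attacker executes the instructions
`(i, 1), ..., (i, τ i)`, passwords being processed in increasing order.
`τ` is valid if `τ i ≤ m` for all `i` and `τ i = 0` outside `[1, n]`. -/
def Valid (P : Params) (τ : ℕ → ℕ) : Prop :=
  (∀ i, τ i ≤ P.m) ∧ ∀ i, i ∉ Finset.Icc 1 P.n → τ i = 0

/-- Success probability `λ(π)` of the checking sequence with exponent vector `τ`. -/
def lam (P : Params) (τ : ℕ → ℕ) : ℝ := ∑ i ∈ Finset.Icc 1 P.n, P.p i * P.Q (τ i)

/-- Probability mass `λ(π, k-1)` of the instructions strictly preceding the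
instruction `(i, j)` in the checking sequence with exponent vector `τ`. -/
def lamBefore (P : Params) (τ : ℕ → ℕ) (i j : ℕ) : ℝ :=
  (∑ i' ∈ Finset.Ico 1 i, P.p i' * P.Q (τ i')) + P.p i * P.Q (j - 1)

/-- Attacker's utility `U(π) = v·λ(π) - Σ_k c(π_k)·(1 - λ(π, k-1))`. -/
def U (P : Params) (τ : ℕ → ℕ) : ℝ :=
  P.v * P.lam τ -
    ∑ i ∈ Finset.Icc 1 P.n, ∑ j ∈ Finset.Icc 1 (τ i), P.rc j * (1 - P.lamBefore τ i j)

/-- A checking sequence is optimal if it maximizes the attacker's utility. -/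
def Optimal (P : Params) (τ : ℕ → ℕ) : Prop :=
  P.Valid τ ∧ ∀ τ', P.Valid τ' → P.U τ' ≤ P.U τ

/-- `π ⊆ π'` for checking sequences: `τ i ≤ τ' i` for all `i`. -/
def Subseq (P : Params) (τ τ' : ℕ → ℕ) : Prop := ∀ i, τ i ≤ τ' i

/-- Truncation of an exponent vector to the first `k` passwords. -/
def truncSeq (τ : ℕ → ℕ) (k : ℕ) : ℕ → ℕ := fun i => if i ≤ k then τ i else 0

/-- `τ` is a possible output of the greedy concatenation algorithm: for
`i = 1, 2, ...` the algorithm appends a block `ϖ_i(1, τ i)` with `τ i ∈ [0, m]`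
maximizing the marginal utility upon concatenation, stopping the first time the
chosen exponent is `0`. -/
def GreedyOutput (P : Params) (τ : ℕ → ℕ) : Prop :=
  P.Valid τ ∧
    ∃ l ≤ P.n,
      (∀ i, 1 ≤ i → i ≤ l → 1 ≤ τ i) ∧
      (∀ i, l < i → τ i = 0) ∧
      (∀ i, 1 ≤ i → i ≤ l → ∀ j ≤ P.m,
        P.U (Function.update (truncSeq τ (i - 1)) i j) ≤ P.U (truncSeq τ i)) ∧
      (l < P.n → ∀ j, 1 ≤ j → j ≤ P.m → P.U (Function.update τ (l + 1) j) ≤ P.U τ)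

lemma Q_mono {P : Params} (hP : P.Hyp) {a b : ℕ} (hab : a ≤ b) (hb : b ≤ P.m) :
    P.Q a ≤ P.Q b := by
  refine Finset.sum_le_sum_of_subset_of_nonneg (Finset.Icc_subset_Icc_right hab) ?_
  intro j hj _
  exact hP.q_nonneg j (Finset.Icc_subset_Icc_right hb hj)

lemma rc_nonneg {P : Params} (hP : P.Hyp) {j : ℕ} (hj : j ∈ Finset.Icc 1 P.m) :
    0 ≤ P.rc j := by
  obtain ⟨h1, hm⟩ := Finset.mem_Icc.mp hj
  have hlt : P.t (j - 1) < P.t j := hP.t_mono _ _ (by omega) hm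
  have h0 : 0 ≤ P.t (j - 1) := by
    rcases Nat.eq_zero_or_pos (j - 1) with h | h
    · rw [h, hP.t_zero]
    · exact hP.t_zero ▸ (hP.t_mono 0 (j - 1) h (by omega)).le
  exact mul_nonneg hP.cM_pos.le (by nlinarith)

/-- Total round cost of a full block `(i, 1), ..., (i, j)`. -/
def blockCost (P : Params) (j : ℕ) : ℝ := ∑ j' ∈ Finset.Icc 1 j, P.rc j'

lemma blockCost_mono {P : Params} (hP : P.Hyp) {a b : ℕ} (hab : a ≤ b) (hb : b ≤ P.m) :
    P.blockCost a ≤ P.blockCost b := by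
  refine Finset.sum_le_sum_of_subset_of_nonneg (Finset.Icc_subset_Icc_right hab) ?_
  intro j hj _
  exact rc_nonneg hP (Finset.Icc_subset_Icc_right hb hj)

/-- The part of the utility contributed by password `i` with exponent `j` that does not
depend on the other exponents. -/
def ownUtility (P : Params) (i j : ℕ) : ℝ :=
  P.v * (P.p i * P.Q j) - ∑ j' ∈ Finset.Icc 1 j, P.rc j' * (1 - P.p i * P.Q (j' - 1))

lemma U_eq_sum (P : Params) (τ : ℕ → ℕ) :
    P.U τ = ∑ i ∈ Finset.Icc 1 P.n, (P.ownUtility i (τ i) +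
      ∑ i' ∈ Finset.Ico 1 i, P.p i' * (P.blockCost (τ i) * P.Q (τ i'))) := by
  rw [U, lam, Finset.mul_sum, ← Finset.sum_sub_distrib]
  refine Finset.sum_congr rfl fun i _ => ?_
  have h : ∑ i' ∈ Finset.Ico 1 i, P.p i' * (P.blockCost (τ i) * P.Q (τ i')) =
      ∑ j ∈ Finset.Icc 1 (τ i), P.rc j * ∑ i' ∈ Finset.Ico 1 i, P.p i' * P.Q (τ i') := by
    rw [← Finset.sum_mul, Finset.mul_sum]
    exact Finset.sum_congr rfl fun i' _ => by rw [blockCost]; ring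
  rw [h, ownUtility, sub_add, ← Finset.sum_sub_distrib]
  congr 1
  exact Finset.sum_congr rfl fun j _ => by rw [lamBefore]; ring

/-- The utility is supermodular on the lattice of exponent vectors. -/
lemma U_add_le_sup_add_inf {P : Params} (hP : P.Hyp) {x y : ℕ → ℕ}
    (hx : ∀ i, x i ≤ P.m) (hy : ∀ i, y i ≤ P.m) :
    P.U x + P.U y ≤ P.U (x ⊔ y) + P.U (x ⊓ y) := by
  simp only [U_eq_sum, ← Finset.sum_add_distrib, Pi.sup_apply, Pi.inf_apply]
  refine Finset.sum_le_sum fun i hi => ?_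
  have own : P.ownUtility i (x i) + P.ownUtility i (y i) =
      P.ownUtility i (x i ⊔ y i) + P.ownUtility i (x i ⊓ y i) := by
    rcases le_total (x i) (y i) with h | h <;> simp [h, add_comm]
  have cross : ∑ i' ∈ Finset.Ico 1 i, P.p i' * (P.blockCost (x i) * P.Q (x i')) +
      ∑ i' ∈ Finset.Ico 1 i, P.p i' * (P.blockCost (y i) * P.Q (y i')) ≤
      ∑ i' ∈ Finset.Ico 1 i, P.p i' * (P.blockCost (x i ⊔ y i) * P.Q (x i' ⊔ y i')) +
      ∑ i' ∈ Finset.Ico 1 i, P.p i' * (P.blockCost (x i ⊓ y i) * P.Q (x i' ⊓ y i')) := by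
    simp only [← Finset.sum_add_distrib, ← mul_add]
    refine Finset.sum_le_sum fun i' hi' => ?_
    have hp : 0 ≤ P.p i' := by
      refine (hP.p_pos i' ?_).le
      simp only [Finset.mem_Icc, Finset.mem_Ico] at *
      omega
    refine mul_le_mul_of_nonneg_left ?_ hp
    rcases le_total (x i) (y i) with h | h <;> rcases le_total (x i') (y i') with h' | h' <;>
      simp only [h, h', sup_of_le_left, sup_of_le_right, inf_of_le_left, inf_of_le_right]
    · linarith
    · nlinarith [blockCost_mono hP h (hy i), Q_mono hP h' (hx i')]
    · nlinarith [blockCost_mono hP h (hx i), Q_mono hP h' (hy i')]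
    · linarith
  linarith

lemma truncSeq_le (τ : ℕ → ℕ) (k : ℕ) : truncSeq τ k ≤ τ := by
  intro i
  rw [truncSeq]
  split_ifs <;> simp

lemma truncSeq_eq_self {τ : ℕ → ℕ} {k : ℕ} (h : ∀ i, k < i → τ i = 0) : truncSeq τ k = τ := by
  ext i
  by_cases hi : i ≤ k
  · simp [truncSeq, hi]
  · simp [truncSeq, hi, h i (by omega)]

/-- A greedy output has the largest utility among the checking sequences it contains. -/
lemma GreedyOutput.U_le {P : Params} (hP : P.Hyp) {τ y : ℕ → ℕ} (hgr : P.GreedyOutput τ)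
    (hy : y ≤ τ) : P.U y ≤ P.U τ := by
  obtain ⟨⟨hτm, hτ0⟩, l, -, -, hzero, hstep, -⟩ := hgr
  have key : ∀ k ≤ l, P.U (truncSeq y k) ≤ P.U (truncSeq τ k) := by
    intro k
    induction k with
    | zero =>
      intro _
      have h0 : τ 0 = 0 := hτ0 0 (by simp)
      have h0' : y 0 = 0 := Nat.le_zero.mp ((hy 0).trans_eq h0)
      refine le_of_eq (congrArg P.U ?_)
      ext i
      rcases Nat.eq_zero_or_pos i with rfl | hi
      · simp [truncSeq, h0, h0']
      · simp [truncSeq, hi.ne']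
    | succ k ih =>
      intro hk
      have hsup : truncSeq τ k ⊔ truncSeq y (k + 1) =
          Function.update (truncSeq τ k) (k + 1) (y (k + 1)) := by
        ext i
        have := hy i
        simp only [truncSeq, Pi.sup_apply, Function.update_apply]
        grind
      have hinf : truncSeq τ k ⊓ truncSeq y (k + 1) = truncSeq y k := by
        ext i
        have := hy i
        simp only [truncSeq, Pi.inf_apply]
        grind
      have hsm := U_add_le_sup_add_inf hP (x := truncSeq τ k) (y := truncSeq y (k + 1))
        (fun i => (truncSeq_le τ k i).trans (hτm i))
        (fun i => (truncSeq_le y (k + 1) i).trans ((hy i).trans (hτm i)))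
      rw [hsup, hinf] at hsm
      have hs := hstep (k + 1) (by omega) hk (y (k + 1)) ((hy _).trans (hτm _))
      rw [Nat.add_sub_cancel] at hs
      linarith [ih (by omega)]
  have h := key l le_rfl
  rwa [truncSeq_eq_self hzero,
    truncSeq_eq_self fun i hi => Nat.le_zero.mp ((hy i).trans_eq (hzero i hi))] at h

lemma finite_setOf_valid (P : Params) : {τ | P.Valid τ}.Finite := by
  let f : {τ | P.Valid τ} → (Fin (P.n + 1) → Fin (P.m + 1)) :=
    fun τ i => ⟨τ.1 i, Nat.lt_succ_of_le (τ.2.1 i)⟩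
  refine Finite.of_injective f fun τ τ' h => Subtype.ext (funext fun i => ?_)
  by_cases hi : i ∈ Finset.Icc 1 P.n
  · have hi' : i < P.n + 1 := Nat.lt_succ_of_le (Finset.mem_Icc.mp hi).2
    exact congrArg Fin.val (congrFun h ⟨i, hi'⟩)
  · rw [τ.2.2 i hi, τ'.2.2 i hi]

lemma exists_optimal (P : Params) : ∃ τ, P.Optimal τ :=
  Set.exists_max_image _ P.U P.finite_setOf_valid
    ⟨fun _ => 0, fun _ => Nat.zero_le _, fun _ _ => rfl⟩

/-- any output of the greedy concatenation algorithm is contained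
in some optimal checking sequence. -/
theorem statement4 (P : Params) (hP : P.Hyp) (τ : ℕ → ℕ) (hgr : P.GreedyOutput τ) :
    ∃ τs, P.Optimal τs ∧ P.Subseq τ τs := by
  obtain ⟨σ, hσ, hmax⟩ := P.exists_optimal
  refine ⟨τ ⊔ σ, ⟨⟨fun i => sup_le (hgr.1.1 i) (hσ.1 i), fun i hi => ?_⟩, fun τ' hτ' => ?_⟩,
    fun i => le_sup_left⟩
  · simp [hgr.1.2 i hi, hσ.2 i hi]
  · have hsm := U_add_le_sup_add_inf hP hgr.1.1 hσ.1
    have hle : P.U (τ ⊓ σ) ≤ P.U τ := hgr.U_le hP inf_le_left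
    linarith [hmax τ' hτ']

end Params
end
end

section
/- Assume cost-even breakpoints (t_j² = j·t_1²) and that peak(q) = {peak₁, m} with 1 ≤ peak₁ < m. Let π be a checking sequence with exponent vector τ satisfying τ_i ∈ {peak₁, m} for all i ≤ ℓ(π) and τ_i = 0 for i > ℓ(π), where ℓ(π) := max{i : τ_i ≥ 1}, and let Unchecked(π) := {ϖ_i(peak₁+1, m) : i ≤ ℓ(π), τ_i = peak₁}. Define S_c(0,π) := ∅ and, for k ≥ 1, S_c(k,π) := S_c(k−1,π) ∪ {e_k} where e_k is a block of Unchecked(π) ∖ S_c(k−1,π) maximizing Δ(e | π ∪ S_c(k−1,π)) over such blocks e. Then for every k with 0 ≤ k ≤ |Unchecked(π)| and every subset S ⊆ Unchecked(π) with |S| = k: Δ(S_c(k,π)|π) ≥ Δ(S|π). -/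
noncomputable section

namespace Params

/-- `j` is a peak of the breakpoint distribution `q`. -/
def IsPeak (P : Params) (j : ℕ) : Prop :=
  1 ≤ j ∧ j ≤ P.m ∧
    (j = P.m ∨ (j = 1 ∧ P.q 2 < P.q 1) ∨
      (1 < j ∧ j < P.m ∧ P.q (j - 1) ≤ P.q j ∧ P.q (j + 1) < P.q j))

/-- Update the exponent vector `τ` to the value `mm` on all indices of `S`. -/
def updSet (τ : ℕ → ℕ) (S : Finset ℕ) (mm : ℕ) : ℕ → ℕ :=
  fun i => if i ∈ S then mm else τ i

/-- With cost-even breakpoints every instruction has the same round cost. -/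
lemma rc_eq_of_cost_even (P : Params) (ht : P.t 0 = 0)
    (hce : ∀ j ∈ Finset.Icc 1 P.m, P.t j ^ 2 = (j : ℝ) * P.t 1 ^ 2)
    {j : ℕ} (hj : j ∈ Finset.Icc 1 P.m) : P.rc j = P.cM * P.t 1 ^ 2 := by
  obtain ⟨h1, hm⟩ := Finset.mem_Icc.1 hj
  obtain ⟨j, rfl⟩ : ∃ j', j = j' + 1 := ⟨j - 1, by omega⟩
  have hpred : P.t j ^ 2 = (j : ℝ) * P.t 1 ^ 2 := by
    rcases Nat.eq_zero_or_pos j with rfl | hpos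
    · simp [ht]
    · exact hce j (Finset.mem_Icc.2 ⟨hpos, by omega⟩)
  rw [rc, hce _ hj, Nat.add_sub_cancel, hpred]
  push_cast
  ring

/-- The part of the utility contributed by password `i` alone when its exponent is `s`
and every round costs `c`. -/
def soloUtility (P : Params) (c : ℝ) (i s : ℕ) : ℝ :=
  P.v * (P.p i * P.Q s) - ∑ j ∈ Finset.Icc 1 s, c * (1 - P.p i * P.Q (j - 1))

lemma U_eq_sum_of_rc_eq (P : Params) {c : ℝ} (hc : ∀ j ∈ Finset.Icc 1 P.m, P.rc j = c)
    {τ : ℕ → ℕ} (hτ : ∀ i, τ i ≤ P.m) :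
    P.U τ = ∑ i ∈ Finset.Icc 1 P.n,
      (P.soloUtility c i (τ i) + c * (τ i * ∑ i' ∈ Finset.Ico 1 i, P.p i' * P.Q (τ i'))) := by
  rw [U, lam, Finset.mul_sum, ← Finset.sum_sub_distrib]
  refine Finset.sum_congr rfl fun i _ => ?_
  have hcost : ∑ j ∈ Finset.Icc 1 (τ i), P.rc j * (1 - P.lamBefore τ i j) =
      ∑ j ∈ Finset.Icc 1 (τ i), (c * (1 - P.p i * P.Q (j - 1)) -
        c * ∑ i' ∈ Finset.Ico 1 i, P.p i' * P.Q (τ i')) := by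
    refine Finset.sum_congr rfl fun j hj => ?_
    rw [hc j (Finset.Icc_subset_Icc_right (hτ i) hj), lamBefore]
    ring
  rw [hcost, Finset.sum_sub_distrib, Finset.sum_const, Nat.card_Icc, soloUtility, nsmul_eq_mul,
    Nat.add_sub_cancel]
  ring

/-- The change of utility when the exponent of a single password is replaced. -/
lemma U_update_sub (P : Params) {c : ℝ} (hc : ∀ j ∈ Finset.Icc 1 P.m, P.rc j = c)
    {τ : ℕ → ℕ} (hτ : ∀ i, τ i ≤ P.m) {y s : ℕ} (hy : y ∈ Finset.Icc 1 P.n) (hs : s ≤ P.m) :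
    P.U (Function.update τ y s) - P.U τ =
      P.soloUtility c y s - P.soloUtility c y (τ y) +
        c * (((s : ℝ) - τ y) * ∑ i ∈ Finset.Ico 1 y, P.p i * P.Q (τ i) +
          P.p y * (P.Q s - P.Q (τ y)) * ∑ i ∈ Finset.Ioc y P.n, (τ i : ℝ)) := by
  obtain ⟨hy1, hyn⟩ := Finset.mem_Icc.1 hy
  have hupd : ∀ i, Function.update τ y s i ≤ P.m := fun i => by
    rcases eq_or_ne i y with rfl | h
    · simpa using hs
    · simpa [h] using hτ i
  have hsplit (f : ℕ → ℝ) : ∑ i ∈ Finset.Icc 1 P.n, f i =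
      ∑ i ∈ Finset.Ico 1 y, f i + f y + ∑ i ∈ Finset.Ioc y P.n, f i := by
    have hset : Finset.Icc 1 P.n = (insert y (Finset.Ico 1 y)) ∪ Finset.Ioc y P.n := by
      ext i; simp only [Finset.mem_Icc, Finset.mem_union, Finset.mem_insert, Finset.mem_Ico,
        Finset.mem_Ioc]; omega
    have hdisj : Disjoint (insert y (Finset.Ico 1 y)) (Finset.Ioc y P.n) := by
      rw [Finset.disjoint_left]; intro i; simp only [Finset.mem_insert, Finset.mem_Ico,
        Finset.mem_Ioc]; omega
    rw [hset, Finset.sum_union hdisj, Finset.sum_insert (by simp)]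
    ring
  have hprefix {i : ℕ} (hi : i ≤ y) :
      ∑ i' ∈ Finset.Ico 1 i, P.p i' * P.Q (Function.update τ y s i') =
        ∑ i' ∈ Finset.Ico 1 i, P.p i' * P.Q (τ i') :=
    Finset.sum_congr rfl fun i' hi' => by
      rw [Function.update_of_ne (by have := (Finset.mem_Ico.1 hi').2; omega)]
  have hlater {i : ℕ} (hi : y < i) :
      ∑ i' ∈ Finset.Ico 1 i, P.p i' * P.Q (Function.update τ y s i') -
        ∑ i' ∈ Finset.Ico 1 i, P.p i' * P.Q (τ i') = P.p y * (P.Q s - P.Q (τ y)) := by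
    rw [← Finset.sum_sub_distrib, Finset.sum_eq_single y]
    · rw [Function.update_self]; ring
    · intro i' _ hne; rw [Function.update_of_ne hne, sub_self]
    · intro h; exact absurd (Finset.mem_Ico.2 ⟨hy1, hi⟩) h
  rw [P.U_eq_sum_of_rc_eq hc hupd, P.U_eq_sum_of_rc_eq hc hτ, ← Finset.sum_sub_distrib, hsplit,
    Finset.sum_eq_zero, hprefix le_rfl, Function.update_self,
    Finset.sum_congr (s₁ := Finset.Ioc y P.n) rfl
      (g := fun i => c * (P.p y * (P.Q s - P.Q (τ y))) * (τ i : ℝ)),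
    ← Finset.mul_sum]
  · ring
  · intro i hi
    have hi := (Finset.mem_Ioc.1 hi).1
    rw [Function.update_of_ne hi.ne', ← hlater hi]
    ring
  · intro i hi
    have hi := (Finset.mem_Ico.1 hi).2
    rw [Function.update_of_ne hi.ne, hprefix hi.le, sub_self]

lemma updSet_insert (τ : ℕ → ℕ) (S : Finset ℕ) (y mm : ℕ) :
    updSet τ (insert y S) mm = Function.update (updSet τ S mm) y mm := by
  funext i
  by_cases h : i = y <;> simp [updSet, h]

lemma updSet_of_notMem {τ : ℕ → ℕ} {S : Finset ℕ} {y : ℕ} (mm : ℕ) (hy : y ∉ S) :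
    updSet τ S mm y = τ y := if_neg hy

lemma updSet_le {τ : ℕ → ℕ} {b : ℕ} (hτ : ∀ i, τ i ≤ b) (S : Finset ℕ) (i : ℕ) :
    updSet τ S b i ≤ b := by
  unfold updSet; split_ifs; exacts [le_rfl, hτ i]

/-- On a set of indices where `τ` is constantly `a`, any function of the updated exponent is an
affine function of the indicator of the updated set. -/
lemma apply_updSet {τ : ℕ → ℕ} {S : Finset ℕ} {a : ℕ} (hS : ∀ i ∈ S, τ i = a) (f : ℕ → ℝ)
    (mm i : ℕ) :
    f (updSet τ S mm i) = f (τ i) + (f mm - f a) * if i ∈ S then 1 else 0 := by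
  unfold updSet
  split_ifs with h
  · rw [hS i h]; ring
  · ring

/-- If two sets of equal size avoid `y` and below `y` the second is contained in the first, then
raising the exponent of `y` gains at least as much on top of the first as on top of the second. -/
lemma marginal_le_marginal (P : Params) {c : ℝ} (hc : ∀ j ∈ Finset.Icc 1 P.m, P.rc j = c)
    (hc0 : 0 ≤ c) {a : ℕ} (ha : a ≤ P.m) (hQ : P.Q a ≤ P.Q P.m)
    (hp : ∀ i ∈ Finset.Icc 1 P.n, ∀ i' ∈ Finset.Icc 1 P.n, i ≤ i' → P.p i' ≤ P.p i)
    {τ : ℕ → ℕ} (hτ : ∀ i, τ i ≤ P.m) {X Z : Finset ℕ} {y : ℕ}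
    (hX : ∀ i ∈ X, i ∈ Finset.Icc 1 P.n ∧ τ i = a) (hZ : ∀ i ∈ Z, i ∈ Finset.Icc 1 P.n ∧ τ i = a)
    (hy : y ∈ Finset.Icc 1 P.n) (hyX : y ∉ X) (hyZ : y ∉ Z) (hya : τ y = a)
    (hcard : X.card = Z.card) (hsub : ∀ i ∈ Z, i < y → i ∈ X) :
    P.U (updSet τ (insert y Z) P.m) - P.U (updSet τ Z P.m) ≤
      P.U (updSet τ (insert y X) P.m) - P.U (updSet τ X P.m) := by
  obtain ⟨hy1, hyn⟩ := Finset.mem_Icc.1 hy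
  rw [updSet_insert, updSet_insert, P.U_update_sub hc (updSet_le hτ Z) hy le_rfl,
    P.U_update_sub hc (updSet_le hτ X) hy le_rfl, updSet_of_notMem _ hyX, updSet_of_notMem _ hyZ,
    hya]
  set x : ℕ → ℝ := fun i => if i ∈ X then 1 else 0 with hx
  set z : ℕ → ℝ := fun i => if i ∈ Z then 1 else 0 with hz
  have hbefore : ∑ i ∈ Finset.Ico 1 y, P.p i * P.Q (updSet τ X P.m i) -
      ∑ i ∈ Finset.Ico 1 y, P.p i * P.Q (updSet τ Z P.m i) =
        (P.Q P.m - P.Q a) * ∑ i ∈ Finset.Ico 1 y, P.p i * (x i - z i) := by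
    rw [← Finset.sum_sub_distrib, Finset.mul_sum]
    refine Finset.sum_congr rfl fun i _ => ?_
    rw [apply_updSet (fun i hi => (hX i hi).2) P.Q, apply_updSet (fun i hi => (hZ i hi).2) P.Q]
    ring
  have hafter : ∑ i ∈ Finset.Ioc y P.n, (updSet τ X P.m i : ℝ) -
      ∑ i ∈ Finset.Ioc y P.n, (updSet τ Z P.m i : ℝ) =
        ((P.m : ℝ) - a) * ∑ i ∈ Finset.Ioc y P.n, (x i - z i) := by
    rw [← Finset.sum_sub_distrib, Finset.mul_sum]
    refine Finset.sum_congr rfl fun i _ => ?_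
    rw [apply_updSet (fun i hi => (hX i hi).2) Nat.cast,
      apply_updSet (fun i hi => (hZ i hi).2) Nat.cast]
    ring
  have hcount {S : Finset ℕ} (hS : ∀ i ∈ S, i ∈ Finset.Icc 1 P.n) :
      ∑ i ∈ Finset.Icc 1 P.n, (if i ∈ S then (1 : ℝ) else 0) = S.card := by
    rw [Finset.sum_ite_mem, Finset.inter_eq_right.2 hS]; simp
  have hbalance : ∑ i ∈ Finset.Ico 1 y, (x i - z i) + ∑ i ∈ Finset.Ioc y P.n, (x i - z i) = 0 := by
    have htotal : ∑ i ∈ Finset.Icc 1 P.n, (x i - z i) = 0 := by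
      rw [Finset.sum_sub_distrib, hcount fun i hi => (hX i hi).1, hcount fun i hi => (hZ i hi).1,
        hcard, sub_self]
    have hdisj : Disjoint (Finset.Ico 1 y) (Finset.Ioc y P.n) := by
      rw [Finset.disjoint_left]; intro i; simp only [Finset.mem_Ico, Finset.mem_Ioc]; omega
    rw [← Finset.sum_union hdisj, ← htotal]
    refine Finset.sum_subset (fun i => ?_) fun i hi hi' => ?_
    · simp only [Finset.mem_union, Finset.mem_Icc, Finset.mem_Ico, Finset.mem_Ioc]; omega
    · simp only [Finset.mem_union, Finset.mem_Icc, Finset.mem_Ico, Finset.mem_Ioc] at hi hi'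
      obtain rfl : i = y := by omega
      simp [hx, hz, hyX, hyZ]
  have hlower : P.p y * ∑ i ∈ Finset.Ico 1 y, (x i - z i) ≤
      ∑ i ∈ Finset.Ico 1 y, P.p i * (x i - z i) := by
    rw [Finset.mul_sum]
    refine Finset.sum_le_sum fun i hi => ?_
    obtain ⟨hi1, hiy⟩ := Finset.mem_Ico.1 hi
    refine mul_le_mul_of_nonneg_right
      (hp i (Finset.mem_Icc.2 ⟨hi1, by omega⟩) y hy hiy.le) ?_
    by_cases hiZ : i ∈ Z
    · simp [hx, hz, hiZ, hsub i hiZ hiy]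
    · simp only [hx, hz, hiZ, if_false, sub_zero]; positivity
  have hgain : 0 ≤ c * (((P.m : ℝ) - a) * (P.Q P.m - P.Q a)) *
      (∑ i ∈ Finset.Ico 1 y, P.p i * (x i - z i) +
        P.p y * ∑ i ∈ Finset.Ioc y P.n, (x i - z i)) := by
    have ham : (a : ℝ) ≤ P.m := by exact_mod_cast ha
    refine mul_nonneg (mul_nonneg hc0 (mul_nonneg (sub_nonneg.2 ham) (sub_nonneg.2 hQ))) ?_
    rw [eq_neg_of_add_eq_zero_right hbalance]
    linarith
  linear_combination hgain - c * ((P.m : ℝ) - a) * hbefore -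
    c * (P.p y * (P.Q P.m - P.Q a)) * hafter

/-- with cost-even breakpoints and `peak(q) = {peak₁, m}`, the
greedily constructed sets `S_c(k, π)` of unchecked blocks `ϖ_i(peak₁ + 1, m)`
provide at least as much marginal utility as any set of the same size. -/
theorem statement17 (P : Params) (hP : P.Hyp)
    (hce : ∀ j ∈ Finset.Icc 1 P.m, P.t j ^ 2 = (j : ℝ) * P.t 1 ^ 2)
    (peak₁ : ℕ) (hp1 : 1 ≤ peak₁) (hp1m : peak₁ < P.m)
    (hpeak : ∀ j, P.IsPeak j ↔ j = peak₁ ∨ j = P.m)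
    (τ : ℕ → ℕ) (hτ : P.Valid τ)
    (l : ℕ) (hln : l ≤ P.n)
    (hτpk : ∀ i, 1 ≤ i → i ≤ l → τ i = peak₁ ∨ τ i = P.m)
    (hτ0 : ∀ i, l < i → τ i = 0)
    (Sc : ℕ → Finset ℕ)
    (hSc0 : Sc 0 = ∅)
    (hstep : ∀ k, 1 ≤ k → k ≤ ((Finset.Icc 1 l).filter fun i => τ i = peak₁).card →
      ∃ e ∈ ((Finset.Icc 1 l).filter fun i => τ i = peak₁) \ Sc (k - 1),
        Sc k = insert e (Sc (k - 1)) ∧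
          ∀ e' ∈ ((Finset.Icc 1 l).filter fun i => τ i = peak₁) \ Sc (k - 1),
            P.U (updSet τ (insert e' (Sc (k - 1))) P.m) ≤
              P.U (updSet τ (insert e (Sc (k - 1))) P.m)) :
    ∀ k ≤ ((Finset.Icc 1 l).filter fun i => τ i = peak₁).card,
      ∀ S ⊆ (Finset.Icc 1 l).filter fun i => τ i = peak₁, S.card = k →
        P.U (updSet τ S P.m) - P.U τ ≤ P.U (updSet τ (Sc k) P.m) - P.U τ := by
  set W := (Finset.Icc 1 l).filter fun i => τ i = peak₁ with hW
  have hWmem : ∀ i ∈ W, i ∈ Finset.Icc 1 P.n ∧ τ i = peak₁ := fun i hi => by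
    obtain ⟨hil, hia⟩ := Finset.mem_filter.1 hi
    exact ⟨Finset.Icc_subset_Icc_right hln hil, hia⟩
  have hQ : P.Q peak₁ ≤ P.Q P.m :=
    Finset.sum_le_sum_of_subset_of_nonneg (Finset.Icc_subset_Icc_right hp1m.le)
      fun j hj _ => hP.q_nonneg j hj
  have hc0 : 0 ≤ P.cM * P.t 1 ^ 2 := mul_nonneg hP.cM_pos.le (sq_nonneg _)
  have hgreedy : ∀ k ≤ W.card, Sc k ⊆ W ∧ (Sc k).card = k ∧
      ∀ S ⊆ W, S.card = k → P.U (updSet τ S P.m) ≤ P.U (updSet τ (Sc k) P.m) := by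
    intro k
    induction k with
    | zero =>
      intro _
      refine ⟨by simp [hSc0], by simp [hSc0], fun S _ hS => ?_⟩
      rw [hSc0, Finset.card_eq_zero.1 hS]
    | succ k ih =>
      intro hk
      obtain ⟨hsub, hcard, hopt⟩ := ih (by omega)
      obtain ⟨e, he, hSk, hmax⟩ := hstep (k + 1) (by omega) hk
      rw [Nat.add_sub_cancel] at he hSk hmax
      obtain ⟨heW, heS⟩ := Finset.mem_sdiff.1 he
      rw [hSk]
      refine ⟨Finset.insert_subset heW hsub, by rw [Finset.card_insert_of_notMem heS, hcard],
        fun Y hY hYcard => ?_⟩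
      have hne : (Y \ Sc k).Nonempty := by
        rw [Finset.sdiff_nonempty]
        intro h
        have := Finset.card_le_card h
        omega
      obtain ⟨y, hy, hymin⟩ := Finset.exists_min_image (Y \ Sc k) id hne
      obtain ⟨hyY, hyS⟩ := Finset.mem_sdiff.1 hy
      have hZcard : (Y.erase y).card = k := by rw [Finset.card_erase_of_mem hyY, hYcard]; rfl
      have hZW : Y.erase y ⊆ W := (Finset.erase_subset _ _).trans hY
      have hmarg := P.marginal_le_marginal (X := Sc k) (Z := Y.erase y) (y := y)
        (fun j hj => P.rc_eq_of_cost_even hP.t_zero hce hj) hc0 hp1m.le hQ hP.p_anti hτ.1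
        (fun i hi => hWmem i (hsub hi)) (fun i hi => hWmem i (hZW hi)) (hWmem y (hY hyY)).1 hyS
        (Finset.notMem_erase y Y) (hWmem y (hY hyY)).2 (hcard.trans hZcard.symm)
        (fun i hi hiy => by
          by_contra hiS
          have : y ≤ i := hymin i (Finset.mem_sdiff.2 ⟨Finset.mem_of_mem_erase hi, hiS⟩)
          omega)
      rw [Finset.insert_erase hyY] at hmarg
      have hZ := hopt _ hZW hZcard
      have hbest := hmax y (Finset.mem_sdiff.2 ⟨hY hyY, hyS⟩)
      linarith
  intro k hk S hS hScard
  exact sub_le_sub_right ((hgreedy k hk).2.2 S hS hScard) _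

end Params
end
end
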